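/- Fix integers P ≥ 1, Q ≥ 1, integers n₁ ≠ n₂, and column index pairs (p₁, q₁), (p₂, q₂) with p₁, p₂ ∈ {0,…,P−1}, q₁, q₂ ∈ {0,…,Q−1} and p₁ ≠ p₂. Then the set of points (x, y) ∈ ℝ² for which the 2×2 matrix with entries [ [exp(−2πi(p₁ x/P + q₁ n₁/Q)), exp(−2πi(p₂ x/P + q₂ n₁/Q))], [exp(−2πi(p₁ y/P + q₁ n₂/Q)), exp(−2πi(p₂ y/P + q₂ n₂/Q))] ] has determinant zero is a set of Lebesgue measure zero in ℝ². (The 2×2 base case in the proof of Theorem 1.) -/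

import Mathlib

open MeasureTheory

/-- An entry of the measurement matrix: `exp(-2πi (p x / P + q n / Q))`,
where the offset `x` is real and `n` is an integer row index. -/
noncomputable def ent (P Q p q : ℕ) (x : ℝ) (n : ℤ) : ℂ :=
  Complex.exp (-(2 * (Real.pi : ℂ) * Complex.I) *
    ((p : ℂ) * (x : ℂ) / (P : ℂ) + (q : ℂ) * (n : ℂ) / (Q : ℂ)))

theorem stmt2 (P Q : ℕ) (hP : 1 ≤ P) (hQ : 1 ≤ Q)
    (n₁ n₂ : ℤ) (hn : n₁ ≠ n₂)
    (p₁ p₂ q₁ q₂ : ℕ) (hp₁ : p₁ < P) (hp₂ : p₂ < P) (hq₁ : q₁ < Q) (hq₂ : q₂ < Q)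
    (hpp : p₁ ≠ p₂) :
    volume {z : ℝ × ℝ |
      Matrix.det !![ent P Q p₁ q₁ z.1 n₁, ent P Q p₂ q₂ z.1 n₁;
                    ent P Q p₁ q₁ z.2 n₂, ent P Q p₂ q₂ z.2 n₂] = 0} = 0 := by
  have hP' : (P : ℝ) ≠ 0 := by positivity
  have hQ' : (Q : ℝ) ≠ 0 := by positivity
  have hd : (p₂ : ℝ) - p₁ ≠ 0 := by
    rw [sub_ne_zero]
    exact_mod_cast hpp.symm
  have hcl : MeasurableSet {z : ℝ × ℝ |
      Matrix.det !![ent P Q p₁ q₁ z.1 n₁, ent P Q p₂ q₂ z.1 n₁;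
                    ent P Q p₁ q₁ z.2 n₂, ent P Q p₂ q₂ z.2 n₂] = 0} := by
    apply IsClosed.measurableSet
    apply isClosed_eq _ continuous_const
    simp only [Matrix.det_fin_two_of, ent]
    fun_prop
  rw [Measure.volume_eq_prod, Measure.measure_prod_null hcl]
  refine Filter.Eventually.of_forall fun x => ?_
  refine Set.Countable.measure_zero (Set.Countable.mono ?_ (Set.countable_range
    (fun k : ℤ => x - ((k : ℝ) - ((q₂ : ℝ) - q₁) * (n₁ - n₂) / Q) * P / ((p₂ : ℝ) - p₁)))) _
  intro y hy
  simp only [Set.mem_preimage, Set.mem_setOf_eq, Matrix.det_fin_two_of, ent, sub_eq_zero,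
    ← Complex.exp_add] at hy
  obtain ⟨k, hk⟩ := Complex.exp_eq_exp_iff_exists_int.1 hy
  refine ⟨k, ?_⟩
  have h2 : (2 * (Real.pi : ℂ) * Complex.I) ≠ 0 := Complex.two_pi_I_ne_zero
  have h3 : ((p₂ : ℂ) - p₁) * (x - y) / P + ((q₂ : ℂ) - q₁) * (n₁ - n₂) / Q = k := by
    apply mul_left_cancel₀ h2
    linear_combination hk
  have h4 : ((p₂ : ℝ) - p₁) * (x - y) / P + ((q₂ : ℝ) - q₁) * (n₁ - n₂) / Q = k := by
    exact_mod_cast h3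
  simp only [← h4]
  field_simp
  ring
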